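/- Let X be a finite subset of ℝ^n and k ≥ 0 an integer with |X| ≥ k+1. Then any two elements of Γ_k(X) have a least upper bound, and any two least upper bounds of the same pair are equivalent (a ≈ b). -/

import Mathlib

open scoped Classical

noncomputable section

namespace DataHomotopy

/-- Points of `ℝ^n` with the Euclidean metric. -/
abbrev Pt (n : ℕ) := EuclideanSpace ℝ (Fin n)

/-- `σ` is a simplex of the Vietoris–Rips complex `V_s(X)`: a nonempty subset of `X`
all of whose pairwise distances are at most `s`. -/
def IsVRSimplex {n : ℕ} (X : Finset (Pt n)) (s : ℝ) (σ : Finset (Pt n)) : Prop :=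
  σ.Nonempty ∧ σ ⊆ X ∧ ∀ x ∈ σ, ∀ y ∈ σ, dist x y ≤ s

/-- `x` is a vertex of the Lesnick complex `L_{s,k}(X)`: `x ∈ X` and there are at least
`k` points of `X`, distinct from `x`, within distance `s` of `x`. -/
def IsLVertex {n : ℕ} (X : Finset (Pt n)) (k : ℕ) (s : ℝ) (x : Pt n) : Prop :=
  x ∈ X ∧ ∃ S : Finset (Pt n), S ⊆ X ∧ x ∉ S ∧ k ≤ S.card ∧ ∀ x' ∈ S, dist x x' ≤ s

/-- `σ` is a simplex of the Lesnick complex `L_{s,k}(X)`: a Vietoris–Rips simplex all of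
whose elements are vertices of `L_{s,k}(X)`. -/
def IsLSimplex {n : ℕ} (X : Finset (Pt n)) (k : ℕ) (s : ℝ) (σ : Finset (Pt n)) : Prop :=
  IsVRSimplex X s σ ∧ ∀ x ∈ σ, IsLVertex X k s x

/-- `x` and `y` lie in the same component of `L_{s,k}(X)`: both are vertices, and they are
joined by a finite chain of vertices with consecutive distances at most `s`. -/
def SameComp {n : ℕ} (X : Finset (Pt n)) (k : ℕ) (s : ℝ) (x y : Pt n) : Prop :=
  IsLVertex X k s x ∧
    Relation.ReflTransGen (fun a b => IsLVertex X k s b ∧ dist a b ≤ s) x y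

/-- `p = (s, x)` is an element of `Γ_k(X)`: `s ≥ 0` and `x` is a vertex of `L_{s,k}(X)`. -/
def InGamma {n : ℕ} (X : Finset (Pt n)) (k : ℕ) (p : ℝ × Pt n) : Prop :=
  0 ≤ p.1 ∧ IsLVertex X k p.1 p.2

/-- The preorder on `Γ_k(X)`: `(s, x) ≼ (t, y)` iff `s ≤ t` and `x`, `y` lie in the same
component of `L_{t,k}(X)`. -/
def GammaLe {n : ℕ} (X : Finset (Pt n)) (k : ℕ) (p q : ℝ × Pt n) : Prop :=
  p.1 ≤ q.1 ∧ SameComp X k q.1 p.2 q.2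

/-- `p = (t, x)` is a branch point of `Γ_k(X)`. -/
def IsBranch {n : ℕ} (X : Finset (Pt n)) (k : ℕ) (p : ℝ × Pt n) : Prop :=
  InGamma X k p ∧
    ((∃ s₀, s₀ < p.1 ∧ ∀ s, s₀ ≤ s → s < p.1 →
        ∃ x₀ x₁ : Pt n, IsLVertex X k s x₀ ∧ IsLVertex X k s x₁ ∧
          ¬ SameComp X k s x₀ x₁ ∧ GammaLe X k (s, x₀) p ∧ GammaLe X k (s, x₁) p) ∨
      ¬ ∃ q : ℝ × Pt n, q.1 < p.1 ∧ InGamma X k q ∧ GammaLe X k q p)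

/-- `c` is a least upper bound of `a` and `b` in `Γ_k(X)`. -/
def IsLUBIn {n : ℕ} (X : Finset (Pt n)) (k : ℕ) (a b c : ℝ × Pt n) : Prop :=
  InGamma X k c ∧ GammaLe X k a c ∧ GammaLe X k b c ∧
    ∀ c', InGamma X k c' → GammaLe X k a c' → GammaLe X k b c' → GammaLe X k c c'

/-- `b` is a maximal branch point below `a` in `Γ_k(X)`. -/
def IsMaxBranchBelow {n : ℕ} (X : Finset (Pt n)) (k : ℕ) (b a : ℝ × Pt n) : Prop :=
  IsBranch X k b ∧ GammaLe X k b a ∧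
    ∀ b', IsBranch X k b' → GammaLe X k b' a → GammaLe X k b' b

/-- The Euclidean distance on `(ℝ^n)^m ≅ ℝ^{nm}` between two `m`-tuples. -/
def tupleDist {n m : ℕ} (y x : Fin m → Pt n) : ℝ :=
  Real.sqrt (∑ i, dist (y i) (x i) ^ 2)

/-- `X^m_dis` is `r`-dense in `Y^m_dis`: every `m`-tuple of pairwise distinct points of `Y`
is within distance `< r` (in `ℝ^{nm}`) of an `m`-tuple of pairwise distinct points of `X`. -/
def ConfigDense {n : ℕ} (X Y : Finset (Pt n)) (m : ℕ) (r : ℝ) : Prop :=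
  ∀ y : Fin m → Pt n, (∀ i, y i ∈ Y) → Function.Injective y →
    ∃ x : Fin m → Pt n, (∀ i, x i ∈ X) ∧ Function.Injective x ∧ tupleDist y x < r

/-- `s` and `t` are consecutive phase-change numbers of `Y`: both are realized as distances
between points of `Y`, `s < t`, and no distance between points of `Y` lies strictly
between `s` and `t`. -/
def IsPhasePair {n : ℕ} (Y : Finset (Pt n)) (s t : ℝ) : Prop :=
  (∃ a ∈ Y, ∃ b ∈ Y, dist a b = s) ∧ (∃ a ∈ Y, ∃ b ∈ Y, dist a b = t) ∧
    s < t ∧ ∀ a ∈ Y, ∀ b ∈ Y, dist a b ≤ s ∨ t ≤ dist a b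

/-- `dS X k s x y = u - s`, where `u` is the least number `u ≥ s` such that `x` and `y`
lie in the same component of `L_{u,k}(X)`. -/
def dS {n : ℕ} (X : Finset (Pt n)) (k : ℕ) (s : ℝ) (x y : Pt n) : ℝ :=
  sInf {u : ℝ | s ≤ u ∧ SameComp X k u x y} - s

theorem IsLVertex.of_dist_imp {n : ℕ} {X : Finset (Pt n)} {k : ℕ} {s t : ℝ}
    (h : ∀ x ∈ X, ∀ y ∈ X, dist x y ≤ s → dist x y ≤ t) {x : Pt n}
    (hx : IsLVertex X k s x) : IsLVertex X k t x := by
  obtain ⟨hxX, S, hSX, hxS, hk, hd⟩ := hx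
  exact ⟨hxX, S, hSX, hxS, hk, fun y hy => h x hxX y (hSX hy) (hd y hy)⟩

theorem IsLVertex.mono {n : ℕ} {X : Finset (Pt n)} {k : ℕ} {s t : ℝ} (hst : s ≤ t) {x : Pt n}
    (hx : IsLVertex X k s x) : IsLVertex X k t x :=
  hx.of_dist_imp fun _ _ _ _ h => h.trans hst

theorem SameComp.right {n : ℕ} {X : Finset (Pt n)} {k : ℕ} {s : ℝ} {x y : Pt n}
    (h : SameComp X k s x y) : IsLVertex X k s y := by
  obtain ⟨hx, h⟩ := h
  cases h with
  | refl => exact hx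
  | tail _ h => exact h.1

theorem SameComp.trans {n : ℕ} {X : Finset (Pt n)} {k : ℕ} {s : ℝ} {x y z : Pt n}
    (hxy : SameComp X k s x y) (hyz : SameComp X k s y z) : SameComp X k s x z :=
  ⟨hxy.1, hxy.2.trans hyz.2⟩

theorem SameComp.symm {n : ℕ} {X : Finset (Pt n)} {k : ℕ} {s : ℝ} {x y : Pt n}
    (h : SameComp X k s x y) : SameComp X k s y x := by
  obtain ⟨hx, h⟩ := h
  induction h with
  | refl => exact ⟨hx, .refl⟩
  | tail hxy hyz ih =>
    exact SameComp.trans ⟨hyz.1, .single ⟨ih.1, by rw [dist_comm]; exact hyz.2⟩⟩ ih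

theorem SameComp.of_dist_imp {n : ℕ} {X : Finset (Pt n)} {k : ℕ} {s t : ℝ}
    (hst : ∀ x ∈ X, ∀ y ∈ X, dist x y ≤ s → dist x y ≤ t) {x y : Pt n}
    (h : SameComp X k s x y) : SameComp X k t x y := by
  obtain ⟨hx, h⟩ := h
  induction h with
  | refl => exact ⟨hx.of_dist_imp hst, .refl⟩
  | tail hxy hyz ih =>
    exact ih.trans ⟨ih.right, .single ⟨hyz.1.of_dist_imp hst,
      hst _ (SameComp.right ⟨hx, hxy⟩).1 _ hyz.1.1 hyz.2⟩⟩

/-- Two vertices of a Lesnick complex at scales at most `T` lie in the same component at some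
scale above `T`, and there is a least such scale. -/
theorem exists_isLeast_sameComp {n : ℕ} (X : Finset (Pt n)) (k : ℕ) {T : ℝ} {x y : Pt n}
    (hx : IsLVertex X k T x) (hy : IsLVertex X k T y) :
    ∃ u, IsLeast {u | T ≤ u ∧ SameComp X k u x y} u := by
  let D : Finset ℝ := insert T ((X ×ˢ X).image fun p => dist p.1 p.2)
  let U : Finset ℝ := D.filter fun u => T ≤ u ∧ SameComp X k u x y
  have hreduce : ∀ u, T ≤ u → SameComp X k u x y → ∃ v ∈ U, v ≤ u := by
    intro u hTu hu
    have hT : T ∈ D.filter (· ≤ u) := Finset.mem_filter.2 ⟨Finset.mem_insert_self _ _, hTu⟩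
    obtain ⟨v, hv, hmax⟩ := (D.filter (· ≤ u)).exists_max_image id ⟨T, hT⟩
    obtain ⟨hvD, hvu⟩ := Finset.mem_filter.1 hv
    refine ⟨v, Finset.mem_filter.2 ⟨hvD, hmax T hT, hu.of_dist_imp ?_⟩, hvu⟩
    intro p hp q hq hpq
    exact hmax _ (Finset.mem_filter.2 ⟨Finset.mem_insert_of_mem
      (Finset.mem_image.2 ⟨(p, q), Finset.mem_product.2 ⟨hp, hq⟩, rfl⟩), hpq⟩)
  obtain ⟨w, hw, -⟩ := hreduce (max T (dist x y)) (le_max_left _ _)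
    ⟨hx.mono (le_max_left _ _), .single ⟨hy.mono (le_max_left _ _), le_max_right _ _⟩⟩
  obtain ⟨u, hu, hmin⟩ := U.exists_min_image id ⟨w, hw⟩
  refine ⟨u, (Finset.mem_filter.1 hu).2, fun v hv => ?_⟩
  obtain ⟨v', hv', hle⟩ := hreduce v hv.1 hv.2
  exact (hmin v' hv').trans hle

theorem stmt6 {n : ℕ} (X : Finset (Pt n)) (k : ℕ) (hcard : k + 1 ≤ X.card)
    (a b : ℝ × Pt n) (ha : InGamma X k a) (hb : InGamma X k b) :
    (∃ c : ℝ × Pt n, IsLUBIn X k a b c) ∧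
    ∀ c c' : ℝ × Pt n, IsLUBIn X k a b c → IsLUBIn X k a b c' →
      GammaLe X k c c' ∧ GammaLe X k c' c := by
  refine ⟨?_, fun c c' hc hc' =>
    ⟨hc.2.2.2 c' hc'.1 hc'.2.1 hc'.2.2.1, hc'.2.2.2 c hc.1 hc.2.1 hc.2.2.1⟩⟩
  obtain ⟨u, ⟨hTu, hu⟩, hmin⟩ := exists_isLeast_sameComp X k
    (ha.2.mono (le_max_left a.1 b.1)) (hb.2.mono (le_max_right a.1 b.1))
  have hau : a.1 ≤ u := (le_max_left _ _).trans hTu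
  have hbu : b.1 ≤ u := (le_max_right _ _).trans hTu
  refine ⟨(u, b.2), ⟨ha.1.trans hau, hu.right⟩, ⟨hau, hu⟩, ⟨hbu, hu.right, .refl⟩, ?_⟩
  intro c' _ hac hbc
  exact ⟨hmin ⟨max_le hac.1 hbc.1, hac.2.trans hbc.2.symm⟩, hbc.2⟩

end DataHomotopy
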